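/- There exist constants c, C > 0 and ℓ₀ ∈ (0, 1/2) such that for every ℓ with 0 < ℓ < ℓ₀, the flatness of Riemann's non-differentiable function in the sense of structure functions satisfies c · log(ℓ⁻¹) ≤ G_R(ℓ) ≤ C · log(ℓ⁻¹), where G_R(ℓ) = S₄(ℓ) / S₂(ℓ)². -/

import Mathlib

open Real MeasureTheory

/-- `σ k = 1` if `k` is a perfect square, `0` otherwise. -/
noncomputable def sqIndicator (k : ℕ) : ℝ := if IsSquare k then 1 else 0

/-- The character `e_k(x) = e^{2πikx}`. -/
noncomputable def eChar (k : ℕ) (x : ℝ) : ℂ :=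
  Complex.exp (2 * Real.pi * Complex.I * (k : ℂ) * (x : ℂ))

/-- Riemann's non-differentiable function `R(x) = ∑_{k≥1} (σ_k/k) e^{2πikx}
    = ∑_{n≥1} e^{2πin²x}/n²`. -/
noncomputable def RiemannF (x : ℝ) : ℂ :=
  ∑' k : ℕ, ((sqIndicator k / k : ℝ) : ℂ) * eChar k x

/-- High-pass filter `R_{≥N}(x) = ∑_{k ≥ N} (σ_k/k) e^{2πikx}`. -/
noncomputable def RiemannHigh (N : ℕ) (x : ℝ) : ℂ :=
  ∑' k : ℕ, if N ≤ k then ((sqIndicator k / k : ℝ) : ℂ) * eChar k x else 0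

/-- The structure function `S_p(ℓ) = ∫₀¹ |R(x+ℓ) − R(x)|^p dx` (for natural `p`). -/
noncomputable def structureFn (p : ℕ) (ℓ : ℝ) : ℝ :=
  ∫ x in (0:ℝ)..1, ‖RiemannF (x + ℓ) - RiemannF x‖ ^ p

/-- The flatness in the sense of structure functions, `G_R(ℓ) = S₄(ℓ)/S₂(ℓ)²`. -/
noncomputable def flatnessSF (ℓ : ℝ) : ℝ := structureFn 4 ℓ / (structureFn 2 ℓ) ^ 2


lemma eChar_norm (k : ℕ) (x : ℝ) : ‖eChar k x‖ = 1 := by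
  have : eChar k x = Complex.exp (((2 * π * k * x : ℝ) : ℂ) * Complex.I) := by
    rw [eChar]; congr 1; push_cast; ring
  rw [this, Complex.norm_exp_ofReal_mul_I]

lemma continuous_eChar (k : ℕ) : Continuous (eChar k) := by
  unfold eChar; fun_prop

lemma eChar_add (j k : ℕ) (x : ℝ) : eChar (j + k) x = eChar j x * eChar k x := by
  simp only [eChar, ← Complex.exp_add]
  congr 1; push_cast; ring

lemma eChar_mul_conj (j k : ℕ) (x : ℝ) : eChar j x * (starRingEnd ℂ) (eChar k x) =
    Complex.exp (2 * π * Complex.I * ((j : ℂ) - k) * x) := by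
  simp only [eChar, ← Complex.exp_conj, ← Complex.exp_add]
  congr 1
  simp only [map_mul, Complex.conj_ofReal, Complex.conj_I, map_natCast, map_ofNat]
  ring

lemma integral_eChar_mul_conj (j k : ℕ) (h : ℝ) :
    ∫ x in (0:ℝ)..1, eChar j (x + h) * (starRingEnd ℂ) (eChar k (x + h)) =
      if j = k then 1 else 0 := by
  simp only [eChar_mul_conj]
  split_ifs with hjk
  · subst hjk; simp
  · have hc : 2 * π * Complex.I * ((j : ℂ) - k) ≠ 0 := by
      have : (j : ℂ) - k ≠ 0 := sub_ne_zero.2 (by exact_mod_cast hjk)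
      have := Complex.two_pi_I_ne_zero
      positivity
    have : ∀ x : ℝ, Complex.exp (2 * π * Complex.I * ((j : ℂ) - k) * ((x + h : ℝ) : ℂ)) =
        Complex.exp (2 * π * Complex.I * ((j : ℂ) - k) * x) *
          Complex.exp (2 * π * Complex.I * ((j : ℂ) - k) * h) := by
      intro x; rw [← Complex.exp_add]; congr 1; push_cast; ring
    simp only [this]
    rw [intervalIntegral.integral_mul_const, integral_exp_mul_complex hc]
    have h1 : Complex.exp (2 * π * Complex.I * ((j : ℂ) - k) * ((1 : ℝ) : ℂ)) = 1 := by
      have := Complex.exp_int_mul_two_pi_mul_I ((j : ℤ) - k)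
      rw [← this]; congr 1; push_cast; ring
    rw [h1]; simp

/-- Parseval's identity for a real-coefficient trigonometric polynomial, frequencies possibly
repeated. -/
lemma integral_norm_sq_sum_eChar {ι : Type*} (s : Finset ι) (A : ι → ℝ) (κ : ι → ℕ) (h : ℝ) :
    ∫ x in (0:ℝ)..1, ‖∑ i ∈ s, (A i : ℂ) * eChar (κ i) (x + h)‖ ^ 2 =
      ∑ i ∈ s, ∑ j ∈ s, if κ i = κ j then A i * A j else 0 := by
  apply Complex.ofReal_injective
  rw [← intervalIntegral.integral_ofReal]
  have key : ∀ x : ℝ, ((‖∑ i ∈ s, (A i : ℂ) * eChar (κ i) (x + h)‖ ^ 2 : ℝ) : ℂ) =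
      ∑ i ∈ s, ∑ j ∈ s, ((A i : ℂ) * A j) *
        (eChar (κ i) (x + h) * (starRingEnd ℂ) (eChar (κ j) (x + h))) := by
    intro x
    push_cast
    rw [← Complex.mul_conj', map_sum, Finset.sum_mul_sum]
    refine Finset.sum_congr rfl fun i _ => Finset.sum_congr rfl fun j _ => ?_
    rw [map_mul, Complex.conj_ofReal]; ring
  have hcont : ∀ i j, Continuous fun x : ℝ => ((A i : ℂ) * A j) *
        (eChar (κ i) (x + h) * (starRingEnd ℂ) (eChar (κ j) (x + h))) := by
    intro i j
    have h1 := (continuous_eChar (κ i)).comp (continuous_add_const h)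
    have h2 := (continuous_eChar (κ j)).comp (continuous_add_const h)
    exact continuous_const.mul (h1.mul (Complex.continuous_conj.comp h2))
  simp only [key]
  rw [intervalIntegral.integral_finsetSum fun i _ =>
    (continuous_finsetSum _ fun j _ => hcont i j).intervalIntegrable _ _]
  push_cast
  refine Finset.sum_congr rfl fun i _ => ?_
  rw [intervalIntegral.integral_finsetSum fun j _ => (hcont i j).intervalIntegrable _ _]
  refine Finset.sum_congr rfl fun j _ => ?_
  rw [intervalIntegral.integral_const_mul, integral_eChar_mul_conj]
  split_ifs <;> simp

/-- The modulus, up to sign, of the coefficient of `e^{2πin²x}` in `R(x + ℓ) - R(x)`. -/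
noncomputable def incrCoeff (ℓ : ℝ) (n : ℕ) : ℝ := 2 * Real.sin (π * n ^ 2 * ℓ) / n ^ 2

/-- The partial sums of `R(x + ℓ) - R(x)`, up to a factor `i`. -/
noncomputable def incrSum (ℓ : ℝ) (M : ℕ) (x : ℝ) : ℂ :=
  ∑ n ∈ Finset.Icc 1 M, (incrCoeff ℓ n : ℂ) * eChar (n ^ 2) (x + ℓ / 2)

lemma continuous_incrSum (ℓ : ℝ) (M : ℕ) : Continuous (incrSum ℓ M) :=
  continuous_finsetSum _ fun n _ =>
    continuous_const.mul ((continuous_eChar (n ^ 2)).comp (continuous_add_const (ℓ / 2)))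

lemma eChar_sub_eChar (k : ℕ) (x ℓ : ℝ) : eChar k (x + ℓ) - eChar k x =
    Complex.I * ((2 * Real.sin (π * k * ℓ) : ℝ) : ℂ) * eChar k (x + ℓ / 2) := by
  push_cast
  rw [Complex.sin, eChar, eChar, eChar]
  have h1 : Complex.exp (2 * π * Complex.I * k * ((x + ℓ : ℝ) : ℂ)) =
      Complex.exp (π * k * ℓ * Complex.I) *
        Complex.exp (2 * π * Complex.I * k * ((x + ℓ / 2 : ℝ) : ℂ)) := by
    rw [← Complex.exp_add]; congr 1; push_cast; ring
  have h2 : Complex.exp (2 * π * Complex.I * k * (x : ℂ)) =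
      Complex.exp (-(π * k * ℓ) * Complex.I) *
        Complex.exp (2 * π * Complex.I * k * ((x + ℓ / 2 : ℝ) : ℂ)) := by
    rw [← Complex.exp_add]; congr 1; push_cast; ring
  rw [h1, h2]
  linear_combination
    (-(Complex.exp (-(π * k * ℓ) * Complex.I) - Complex.exp (π * k * ℓ * Complex.I)) *
      Complex.exp (2 * π * Complex.I * k * ((x + ℓ / 2 : ℝ) : ℂ))) * Complex.I_sq

lemma summable_riemann_terms (x : ℝ) :
    Summable fun n : ℕ => (((1 : ℝ) / (n : ℝ) ^ 2 : ℝ) : ℂ) * eChar (n ^ 2) x := by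
  refine Summable.of_norm ?_
  refine (Real.summable_one_div_nat_pow.2 one_lt_two).congr fun n => ?_
  rw [norm_mul, eChar_norm, Complex.norm_real, Real.norm_of_nonneg (by positivity), mul_one]

lemma RiemannF_eq_tsum (x : ℝ) :
    RiemannF x = ∑' n : ℕ, (((1 : ℝ) / (n : ℝ) ^ 2 : ℝ) : ℂ) * eChar (n ^ 2) x := by
  have hinj : Function.Injective fun n : ℕ => n ^ 2 := Nat.pow_left_injective (by norm_num)
  rw [RiemannF]
  refine (Function.Injective.tsum_eq hinj ?_).symm.trans (tsum_congr fun n => ?_)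
  · intro k hk
    by_contra hcon
    refine hk ?_
    have : ¬ IsSquare k := fun ⟨r, hr⟩ => hcon ⟨r, by simp [hr, sq]⟩
    simp [sqIndicator, this]
  · have : IsSquare (n ^ 2) := ⟨n, sq n⟩
    simp [sqIndicator, this]

lemma tendsto_norm_incrSum (ℓ x : ℝ) :
    Filter.Tendsto (fun M => ‖incrSum ℓ M x‖) Filter.atTop
      (nhds ‖RiemannF (x + ℓ) - RiemannF x‖) := by
  have h := ((summable_riemann_terms (x + ℓ)).hasSum.sub
    (summable_riemann_terms x).hasSum).tendsto_sum_nat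
  rw [← RiemannF_eq_tsum, ← RiemannF_eq_tsum] at h
  refine ((h.comp (Filter.tendsto_add_atTop_nat 1)).norm).congr fun M => ?_
  have : ∑ n ∈ Finset.range (M + 1), ((((1 : ℝ) / (n : ℝ) ^ 2 : ℝ) : ℂ) * eChar (n ^ 2) (x + ℓ) -
      (((1 : ℝ) / (n : ℝ) ^ 2 : ℝ) : ℂ) * eChar (n ^ 2) x) = Complex.I * incrSum ℓ M x := by
    rw [Finset.range_eq_Ico, Finset.sum_eq_sum_Ico_succ_bot (Nat.succ_pos _), incrSum,
      Finset.mul_sum]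
    simp only [Nat.cast_zero, ne_eq, two_ne_zero, not_false_eq_true, zero_pow, div_zero,
      Complex.ofReal_zero, zero_mul, sub_zero, zero_add]
    refine Finset.sum_congr (by ext n; simp) fun n _ => ?_
    have := eChar_sub_eChar (n ^ 2) x ℓ
    rw [← mul_sub, this, incrCoeff]
    push_cast
    ring
  simp only [Function.comp]
  rw [this, norm_mul, Complex.norm_I, one_mul]

lemma abs_incrCoeff_le_two_div (ℓ : ℝ) (n : ℕ) : |incrCoeff ℓ n| ≤ 2 / n ^ 2 := by
  rw [incrCoeff, abs_div, abs_mul, abs_of_nonneg (by positivity : (0:ℝ) ≤ n ^ 2)]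
  have := Real.abs_sin_le_one (π * n ^ 2 * ℓ)
  norm_num
  gcongr
  linarith

lemma tendsto_integral_incrSum (ℓ : ℝ) (p : ℕ) :
    Filter.Tendsto (fun M => ∫ x in (0:ℝ)..1, ‖incrSum ℓ M x‖ ^ p) Filter.atTop
      (nhds (structureFn p ℓ)) := by
  have hs : Summable fun n : ℕ => (2 : ℝ) / (n : ℝ) ^ 2 := by
    simpa [div_eq_mul_inv] using (Real.summable_one_div_nat_pow.2 one_lt_two).mul_left 2
  refine intervalIntegral.tendsto_integral_filter_of_dominated_convergence
    (fun _ => (∑' n : ℕ, (2 : ℝ) / (n : ℝ) ^ 2) ^ p) ?_ ?_ ?_ ?_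
  · exact .of_forall fun M => ((continuous_incrSum ℓ M).norm.pow p).aestronglyMeasurable
  · refine .of_forall fun M => .of_forall fun x _ => ?_
    rw [norm_pow, norm_norm]
    gcongr
    refine (norm_sum_le _ _).trans ?_
    refine le_trans (Finset.sum_le_sum fun n _ => ?_)
      (hs.sum_le_tsum (Finset.Icc 1 M) fun n _ => by positivity)
    rw [norm_mul, eChar_norm, mul_one, Complex.norm_real, Real.norm_eq_abs]
    exact abs_incrCoeff_le_two_div ℓ n
  · exact intervalIntegrable_const
  · exact .of_forall fun x _ => (tendsto_norm_incrSum ℓ x).pow p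

lemma integral_incrSum_sq (ℓ : ℝ) (M : ℕ) :
    ∫ x in (0:ℝ)..1, ‖incrSum ℓ M x‖ ^ 2 = ∑ n ∈ Finset.Icc 1 M, incrCoeff ℓ n ^ 2 := by
  simp only [incrSum]
  rw [integral_norm_sq_sum_eChar _ (incrCoeff ℓ) (fun n => n ^ 2) (ℓ / 2)]
  refine Finset.sum_congr rfl fun n hn => ?_
  have hinj : ∀ m, n ^ 2 = m ^ 2 ↔ n = m := fun m => (Nat.pow_left_injective two_ne_zero).eq_iff
  simp only [hinj]
  rw [Finset.sum_ite_eq, if_pos hn, sq]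

lemma integral_incrSum_four (ℓ : ℝ) (M : ℕ) :
    ∫ x in (0:ℝ)..1, ‖incrSum ℓ M x‖ ^ 4 =
      ∑ p ∈ Finset.Icc 1 M ×ˢ Finset.Icc 1 M, ∑ q ∈ Finset.Icc 1 M ×ˢ Finset.Icc 1 M,
        if p.1 ^ 2 + p.2 ^ 2 = q.1 ^ 2 + q.2 ^ 2 then
          (incrCoeff ℓ p.1 * incrCoeff ℓ p.2) * (incrCoeff ℓ q.1 * incrCoeff ℓ q.2) else 0 := by
  rw [← integral_norm_sq_sum_eChar _ (fun p : ℕ × ℕ => incrCoeff ℓ p.1 * incrCoeff ℓ p.2)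
    (fun p => p.1 ^ 2 + p.2 ^ 2) (ℓ / 2)]
  congr 1 with x
  rw [show (4 : ℕ) = 2 * 2 from rfl, pow_mul, ← norm_pow, sq (incrSum ℓ M x), incrSum,
    Finset.sum_mul_sum, ← Finset.sum_product']
  congr 2
  refine Finset.sum_congr rfl fun p _ => ?_
  rw [eChar_add]; push_cast; ring

lemma abs_incrCoeff_le {ℓ : ℝ} (hℓ : 0 ≤ ℓ) (n : ℕ) : |incrCoeff ℓ n| ≤ 2 * π * ℓ := by
  have hpi := Real.pi_pos
  rcases Nat.eq_zero_or_pos n with rfl | hn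
  · simp [incrCoeff]; positivity
  · have hn' : (0:ℝ) < n := by exact_mod_cast hn
    have h := Real.abs_sin_le_abs (x := π * n ^ 2 * ℓ)
    rw [abs_of_nonneg (by positivity : 0 ≤ π * n ^ 2 * ℓ)] at h
    rw [incrCoeff, abs_div, abs_mul, abs_of_nonneg (by positivity : (0:ℝ) ≤ n ^ 2), abs_two,
      div_le_iff₀ (by positivity)]
    nlinarith

lemma four_mul_le_incrCoeff {ℓ : ℝ} (hℓ : 0 ≤ ℓ) {n : ℕ} (hn : 0 < n) (h : 2 * n ^ 2 * ℓ ≤ 1) :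
    4 * ℓ ≤ incrCoeff ℓ n := by
  have hpi := Real.pi_pos
  have hn' : (0:ℝ) < n := by exact_mod_cast hn
  have h1 := Real.mul_le_sin (x := π * n ^ 2 * ℓ) (by positivity) (by nlinarith)
  rw [incrCoeff, le_div_iff₀ (by positivity)]
  have : 2 / π * (π * n ^ 2 * ℓ) = 2 * n ^ 2 * ℓ := by field_simp
  linarith

/-- Quadruples in `[1, L]` with `n₁² + n₂² = m₁² + m₂²`. -/
def sqSols (L : ℕ) : Finset ((ℕ × ℕ) × (ℕ × ℕ)) :=
  {z ∈ (Finset.Icc 1 L ×ˢ Finset.Icc 1 L) ×ˢ (Finset.Icc 1 L ×ˢ Finset.Icc 1 L) |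
    z.1.1 ^ 2 + z.1.2 ^ 2 = z.2.1 ^ 2 + z.2.2 ^ 2}

lemma mem_sqSols {L a b c d : ℕ} : ((a, b), (c, d)) ∈ sqSols L ↔
    (((1 ≤ a ∧ a ≤ L) ∧ (1 ≤ b ∧ b ≤ L)) ∧ ((1 ≤ c ∧ c ≤ L) ∧ (1 ≤ d ∧ d ≤ L))) ∧
      a ^ 2 + b ^ 2 = c ^ 2 + d ^ 2 := by
  simp only [sqSols, Finset.mem_filter, Finset.mem_product, Finset.mem_Icc]

lemma exists_mul_eq_mul_factors {u v s t : ℕ} (hu : 0 < u) (h : u * v = s * t) :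
    ∃ α β γ δ, u = α * β ∧ s = α * γ ∧ v = γ * δ ∧ t = β * δ := by
  obtain ⟨α, β, ⟨γ, hγ⟩, ⟨δ, hδ⟩, huab⟩ := exists_dvd_and_dvd_of_dvd_mul (Dvd.intro v h)
  refine ⟨α, β, γ, δ, huab, hγ, ?_, hδ⟩
  apply Nat.eq_of_mul_eq_mul_left hu
  rw [h, hγ, hδ, huab]; ring

lemma sum_div_max_sq_le (W : ℕ) :
    ∑ p ∈ Finset.Icc 1 W ×ˢ Finset.Icc 1 W, (((W / max p.1 p.2) ^ 2 : ℕ) : ℝ) ≤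
      2 * W ^ 2 * (1 + Real.log W) := by
  have hH : ∑ b ∈ Finset.Icc 1 W, ((b : ℝ))⁻¹ ≤ 1 + Real.log W := by
    have := harmonic_le_one_add_log W
    simpa [harmonic_eq_sum_Icc] using this
  have hrow : ∀ b ∈ Finset.Icc 1 W,
      ∑ c ∈ Finset.Icc 1 W, (if c ≤ b then (W : ℝ) ^ 2 / b ^ 2 else 0) ≤ W ^ 2 * (b : ℝ)⁻¹ := by
    intro b hb
    have hb' : (0:ℝ) < b := by exact_mod_cast (Finset.mem_Icc.1 hb).1
    rw [← Finset.sum_filter, Finset.sum_const, nsmul_eq_mul]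
    have hc : (Finset.filter (fun c => c ≤ b) (Finset.Icc 1 W)).card ≤ b := by
      calc _ ≤ (Finset.Icc 1 b).card := Finset.card_le_card fun c hc => by
            simp only [Finset.mem_filter, Finset.mem_Icc] at hc ⊢; omega
        _ = b := by simp
    calc _ ≤ (b : ℝ) * ((W : ℝ) ^ 2 / b ^ 2) := by gcongr
      _ = _ := by field_simp
  have hpt : ∀ p ∈ Finset.Icc 1 W ×ˢ Finset.Icc 1 W, (((W / max p.1 p.2) ^ 2 : ℕ) : ℝ) ≤
      (if p.2 ≤ p.1 then (W : ℝ) ^ 2 / p.1 ^ 2 else 0) +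
        (if p.1 ≤ p.2 then (W : ℝ) ^ 2 / p.2 ^ 2 else 0) := by
    rintro ⟨b, c⟩ -
    push_cast
    have h : ((W / max b c : ℕ) : ℝ) ^ 2 ≤ ((W : ℝ) / (max b c : ℕ)) ^ 2 := by
      gcongr; exact Nat.cast_div_le
    rw [div_pow] at h
    rcases le_total b c with hbc | hbc
    · rw [max_eq_right hbc] at h ⊢
      simp only [hbc, if_true]
      have : (0:ℝ) ≤ if c ≤ b then (W : ℝ) ^ 2 / b ^ 2 else 0 := by positivity
      linarith
    · rw [max_eq_left hbc] at h ⊢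
      simp only [hbc, if_true]
      have : (0:ℝ) ≤ if b ≤ c then (W : ℝ) ^ 2 / c ^ 2 else 0 := by positivity
      linarith
  refine (Finset.sum_le_sum hpt).trans ?_
  rw [Finset.sum_add_distrib, Finset.sum_product, Finset.sum_product_right]
  have h1 := Finset.sum_le_sum hrow
  rw [← Finset.mul_sum] at h1
  have h2 := mul_le_mul_of_nonneg_left hH (by positivity : (0:ℝ) ≤ (W : ℝ) ^ 2)
  simp only at h1 ⊢
  linarith

lemma card_sqSols_gt_le (L : ℕ) :
    ((Finset.card {z ∈ sqSols L | z.2.1 < z.1.1} : ℕ) : ℝ) ≤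
      8 * L ^ 2 * (1 + Real.log (2 * L)) := by
  set T : Finset (Σ _ : ℕ × ℕ, ℕ × ℕ) :=
    (Finset.Icc 1 (2 * L) ×ˢ Finset.Icc 1 (2 * L)).sigma fun p =>
      Finset.Icc 1 (2 * L / max p.1 p.2) ×ˢ Finset.Icc 1 (2 * L / max p.1 p.2) with hT
  have hsub : {z ∈ sqSols L | z.2.1 < z.1.1} ⊆ T.image fun w =>
      (((w.2.1 * w.1.1 + w.1.2 * w.2.2) / 2, (w.1.1 * w.2.2 - w.2.1 * w.1.2) / 2),
        ((w.1.2 * w.2.2 - w.2.1 * w.1.1) / 2, (w.2.1 * w.1.2 + w.1.1 * w.2.2) / 2)) := by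
    rintro ⟨⟨n₁, n₂⟩, ⟨m₁, m₂⟩⟩ hz
    rw [Finset.mem_filter, mem_sqSols] at hz
    obtain ⟨⟨⟨⟨⟨h1, h2⟩, ⟨h3, h4⟩⟩, ⟨h5, h6⟩, ⟨h7, h8⟩⟩, heq⟩, hlt⟩ := hz
    simp only at hlt
    have hlt' : n₂ < m₂ := by
      by_contra hcon
      push Not at hcon
      nlinarith
    obtain ⟨u, rfl⟩ := Nat.exists_eq_add_of_lt hlt
    obtain ⟨s, rfl⟩ := Nat.exists_eq_add_of_lt hlt'
    obtain ⟨α, β, γ, δ, e1, e2, e3, e4⟩ := exists_mul_eq_mul_factors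
      (u := u + 1) (v := m₁ + (m₁ + u + 1)) (s := s + 1) (t := n₂ + (n₂ + s + 1)) (by omega)
      (by nlinarith)
    have hα : 0 < α := Nat.pos_of_ne_zero (by rintro rfl; simp at e1)
    have hβ : 0 < β := Nat.pos_of_ne_zero (by rintro rfl; simp at e1)
    have hγ : 0 < γ := Nat.pos_of_ne_zero (by rintro rfl; simp at e2)
    have hδ : 0 < δ := Nat.pos_of_ne_zero (by rintro rfl; simp at e3)
    refine Finset.mem_image.2 ⟨⟨(β, γ), (α, δ)⟩, ?_, ?_⟩
    · simp only [hT, Finset.mem_sigma, Finset.mem_product, Finset.mem_Icc]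
      have hmax : 0 < max β γ := lt_max_of_lt_left hβ
      have b1 : α * β ≤ 2 * L := by omega
      have b2 : α * γ ≤ 2 * L := by omega
      have b3 : δ * γ ≤ 2 * L := by rw [mul_comm]; omega
      have b4 : δ * β ≤ 2 * L := by rw [mul_comm]; omega
      refine ⟨⟨⟨hβ, ?_⟩, hγ, ?_⟩, ⟨hα, ?_⟩, hδ, ?_⟩
      · nlinarith
      · nlinarith
      · rw [Nat.le_div_iff_mul_le hmax]
        rcases le_total β γ with h | h
        · rwa [max_eq_right h]
        · rwa [max_eq_left h]
      · rw [Nat.le_div_iff_mul_le hmax]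
        rcases le_total β γ with h | h
        · rwa [max_eq_right h]
        · rwa [max_eq_left h]
    · simp only [Prod.mk.injEq]
      omega
  have hcard : Finset.card {z ∈ sqSols L | z.2.1 < z.1.1} ≤
      ∑ p ∈ Finset.Icc 1 (2 * L) ×ˢ Finset.Icc 1 (2 * L), (2 * L / max p.1 p.2) ^ 2 := by
    refine (Finset.card_le_card hsub).trans (Finset.card_image_le.trans ?_)
    rw [hT, Finset.card_sigma]
    refine le_of_eq (Finset.sum_congr rfl fun p _ => ?_)
    simp [sq]
  have h := sum_div_max_sq_le (2 * L)
  rw [← Nat.cast_sum] at h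
  have h' : ((Finset.card {z ∈ sqSols L | z.2.1 < z.1.1} : ℕ) : ℝ) ≤ _ :=
    (Nat.cast_le.2 hcard).trans h
  push_cast at h'
  linarith

lemma card_sqSols_le (L : ℕ) :
    ((sqSols L).card : ℝ) ≤ L ^ 2 * (17 + 16 * Real.log (2 * L)) := by
  set O := Finset.filter (fun z : (ℕ × ℕ) × (ℕ × ℕ) => z.2.1 < z.1.1) (sqSols L) with hO
  have hsub : sqSols L ⊆ (Finset.Icc 1 L ×ˢ Finset.Icc 1 L).image (fun p => (p, p)) ∪
      (O ∪ O.image Prod.swap) := by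
    rintro ⟨⟨n₁, n₂⟩, ⟨m₁, m₂⟩⟩ hz
    have hz' := mem_sqSols.1 hz
    simp only [Finset.mem_union, Finset.mem_image, hO, Finset.mem_filter]
    rcases lt_trichotomy m₁ n₁ with h | h | h
    · exact .inr (.inl ⟨hz, h⟩)
    · left
      subst h
      have : n₂ = m₂ := Nat.pow_left_injective two_ne_zero (Nat.add_left_cancel hz'.2)
      subst this
      exact ⟨(m₁, n₂), by simp only [Finset.mem_product, Finset.mem_Icc]; exact hz'.1.1, rfl⟩
    · refine .inr (.inr ⟨((m₁, m₂), (n₁, n₂)), ⟨?_, h⟩, rfl⟩)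
      exact mem_sqSols.2 ⟨hz'.1.symm, hz'.2.symm⟩
  have hc : (sqSols L).card ≤ L * L + (O.card + O.card) := by
    refine (Finset.card_le_card hsub).trans ((Finset.card_union_le _ _).trans ?_)
    refine add_le_add (Finset.card_image_le.trans (by simp)) ?_
    exact (Finset.card_union_le _ _).trans (add_le_add le_rfl Finset.card_image_le)
  have hc' : ((sqSols L).card : ℝ) ≤ L * L + (O.card + O.card) := by exact_mod_cast hc
  have := card_sqSols_gt_le L
  nlinarith

lemma log_le_two_mul_sum_totient_div_sq (Y : ℕ) :
    Real.log (Y + 1) ≤ 2 * ∑ g ∈ Finset.Icc 1 Y, (Nat.totient g : ℝ) / g ^ 2 := by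
  have hlog : Real.log (Y + 1) ≤ ∑ n ∈ Finset.Icc 1 Y, ((n : ℝ))⁻¹ := by
    have := log_add_one_le_harmonic Y
    simpa [harmonic_eq_sum_Icc] using this
  have hsq : ∑ m ∈ Finset.Icc 1 Y, ((m : ℝ) ^ 2)⁻¹ ≤ 2 := by
    have := sum_Ioo_inv_sq_le (α := ℝ) 0 (Y + 1)
    rw [show Finset.Icc 1 Y = Finset.Ioo 0 (Y + 1) by ext; simp; omega]
    simpa using this
  refine hlog.trans ?_
  have h1 : ∀ n ∈ Finset.Icc 1 Y, ((n : ℝ))⁻¹ =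
      ∑ g ∈ Finset.Icc 1 Y, if g ∣ n then (Nat.totient g : ℝ) / n ^ 2 else 0 := by
    intro n hn
    rw [Finset.mem_Icc] at hn
    have hn0 : (n : ℝ) ≠ 0 := by exact_mod_cast (by omega : n ≠ 0)
    rw [← Finset.sum_filter, ← Finset.sum_div]
    have : Finset.filter (fun g => g ∣ n) (Finset.Icc 1 Y) = n.divisors := by
      ext g
      simp only [Finset.mem_filter, Finset.mem_Icc, Nat.mem_divisors]
      constructor
      · rintro ⟨-, h⟩; exact ⟨h, by omega⟩
      · rintro ⟨h, -⟩
        exact ⟨⟨Nat.pos_of_dvd_of_pos h hn.1, (Nat.le_of_dvd hn.1 h).trans hn.2⟩, h⟩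
    rw [this, ← Nat.cast_sum, Nat.sum_totient]
    field_simp
  rw [Finset.sum_congr rfl h1, Finset.sum_comm, Finset.mul_sum]
  refine Finset.sum_le_sum fun g hg => ?_
  have hg1 : 0 < g := (Finset.mem_Icc.1 hg).1
  rw [← Finset.sum_filter]
  have hsub : Finset.filter (fun n => g ∣ n) (Finset.Icc 1 Y) ⊆
      (Finset.Icc 1 Y).image (fun m => g * m) := by
    intro n hn
    simp only [Finset.mem_filter, Finset.mem_Icc] at hn
    obtain ⟨⟨h1, h2⟩, m, rfl⟩ := hn
    refine Finset.mem_image.2 ⟨m, ?_, rfl⟩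
    rw [Finset.mem_Icc]
    exact ⟨Nat.pos_of_ne_zero (by rintro rfl; simp at h1), by nlinarith⟩
  calc _ ≤ ∑ n ∈ (Finset.Icc 1 Y).image (fun m => g * m), (Nat.totient g : ℝ) / n ^ 2 :=
        Finset.sum_le_sum_of_subset_of_nonneg hsub fun n _ _ => by positivity
    _ = ∑ m ∈ Finset.Icc 1 Y, (Nat.totient g : ℝ) / (g * m : ℕ) ^ 2 :=
        Finset.sum_image fun a _ b _ h => Nat.eq_of_mul_eq_mul_left hg1 h
    _ = (Nat.totient g : ℝ) / g ^ 2 * ∑ m ∈ Finset.Icc 1 Y, ((m : ℝ) ^ 2)⁻¹ := by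
        rw [Finset.mul_sum]
        refine Finset.sum_congr rfl fun m _ => ?_
        push_cast
        rw [mul_pow, div_mul_eq_div_div, div_eq_mul_inv (_ / _)]
    _ ≤ (Nat.totient g : ℝ) / g ^ 2 * 2 := by gcongr
    _ = _ := mul_comm _ _

lemma eq_of_mul_eq_of_coprime {a a' p p' q q' : ℕ} (h : Nat.Coprime p q) (h' : Nat.Coprime p' q')
    (h1 : a * p = a' * p') (h2 : a * q = a' * q') : a = a' := by
  have e := Nat.gcd_mul_left a p q
  have e' := Nat.gcd_mul_left a' p' q'
  rw [h1, h2, e', h.gcd_eq_one, h'.gcd_eq_one] at e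
  simpa using e.symm

lemma sum_totient_mul_sq_le_card {Y K M : ℕ} (hK : 50 * Y ^ 2 ≤ K) (hM : K ≤ M) :
    ∑ g ∈ Finset.Icc 1 Y, Nat.totient g * (Y / g) ^ 2 ≤
      Finset.card {z ∈ sqSols M | z.1.1 ^ 2 + z.1.2 ^ 2 ≤ K} := by
  set T : Finset (Σ _ : ℕ, ℕ × (ℕ × ℕ)) := (Finset.Icc 1 Y).sigma fun g =>
    {b ∈ Finset.range g | g.Coprime b} ×ˢ
      (Finset.Icc 1 (Y / g) ×ˢ Finset.Ioc (2 * (Y / g)) (3 * (Y / g))) with hT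
  have hcard : T.card = ∑ g ∈ Finset.Icc 1 Y, Nat.totient g * (Y / g) ^ 2 := by
    rw [hT, Finset.card_sigma]
    refine Finset.sum_congr rfl fun g _ => ?_
    rw [Finset.card_product, Finset.card_product, Nat.totient_eq_card_coprime, Nat.card_Icc,
      Nat.card_Ioc, sq]
    congr 2
    omega
  have hmem : ∀ {g b a d : ℕ}, (⟨g, (b, (a, d))⟩ : Σ _ : ℕ, ℕ × (ℕ × ℕ)) ∈ T →
      (0 < g ∧ 0 < a ∧ g.Coprime (g + b) ∧ a * g < (g + b) * d ∧ a * (g + b) < g * d ∧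
        (a ^ 2 + d ^ 2) * (g ^ 2 + (g + b) ^ 2) ≤ 50 * Y ^ 2) := by
    intro g b a d h
    simp only [hT, Finset.mem_sigma, Finset.mem_product, Finset.mem_Icc, Finset.mem_Ioc,
      Finset.mem_filter, Finset.mem_range] at h
    obtain ⟨⟨hg, hgY⟩, ⟨hb, hco⟩, ⟨ha, haT⟩, hd1, hd2⟩ := h
    have hTg : Y / g * g ≤ Y := Nat.div_mul_le_self Y g
    generalize Y / g = t at *
    refine ⟨hg, ha, by simpa using hco, by nlinarith, by nlinarith, ?_⟩
    calc (a ^ 2 + d ^ 2) * (g ^ 2 + (g + b) ^ 2)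
        ≤ (t ^ 2 + (3 * t) ^ 2) * (g ^ 2 + (g + g) ^ 2) := by gcongr
      _ = 50 * (t * g) ^ 2 := by ring
      _ ≤ 50 * Y ^ 2 := by gcongr
  rw [← hcard]
  refine Finset.card_le_card_of_injOn (fun w =>
      ((w.2.2.1 * w.1 + (w.1 + w.2.1) * w.2.2.2, w.1 * w.2.2.2 - w.2.2.1 * (w.1 + w.2.1)),
        ((w.1 + w.2.1) * w.2.2.2 - w.2.2.1 * w.1, w.2.2.1 * (w.1 + w.2.1) + w.1 * w.2.2.2)))
    ?_ ?_
  · rintro ⟨g, b, a, d⟩ hw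
    obtain ⟨hg, ha, -, h1, h2, h3⟩ := hmem hw
    simp only [Finset.coe_filter, Set.mem_ofPred_eq]
    obtain ⟨m, hm⟩ := Nat.exists_eq_add_of_lt h1
    obtain ⟨n, hn⟩ := Nat.exists_eq_add_of_lt h2
    have em : (g + b) * d - a * g = m + 1 := by omega
    have en : g * d - a * (g + b) = n + 1 := by omega
    rw [em, en]
    have hmz : (m : ℤ) = (g + b) * d - a * g - 1 := by zify at hm; linarith
    have hnz : (n : ℤ) = g * d - a * (g + b) - 1 := by zify at hn; linarith
    have hsum : (a * g + (g + b) * d) ^ 2 + (n + 1) ^ 2 =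
        (a ^ 2 + d ^ 2) * (g ^ 2 + (g + b) ^ 2) := by
      zify; rw [hnz]; ring
    have heq : (a * g + (g + b) * d) ^ 2 + (n + 1) ^ 2 =
        (m + 1) ^ 2 + (a * (g + b) + g * d) ^ 2 := by
      zify; rw [hnz, hmz]; ring
    have hagpos : 0 < a * g := Nat.mul_pos ha hg
    have hle : ∀ k r : ℕ, k ^ 2 + r ≤ K → k ≤ M := fun k r h => by nlinarith
    have hle' : ∀ k r : ℕ, r + k ^ 2 ≤ K → k ≤ M := fun k r h => by nlinarith
    have hKK : (a * g + (g + b) * d) ^ 2 + (n + 1) ^ 2 ≤ K := by omega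
    refine ⟨mem_sqSols.2 ⟨⟨⟨⟨by omega, hle _ _ hKK⟩, by omega, hle' _ _ hKK⟩, ⟨by omega,
      hle _ _ (heq ▸ hKK)⟩, by omega, hle' _ _ (heq ▸ hKK)⟩, heq⟩, hKK⟩
  · rintro ⟨g, b, a, d⟩ hw ⟨g', b', a', d'⟩ hw' h
    obtain ⟨hg, ha, hco, h1, h2, -⟩ := hmem hw
    obtain ⟨hg', ha', hco', h1', h2', -⟩ := hmem hw'
    simp only [Prod.mk.injEq] at h
    obtain ⟨⟨e1, e2⟩, e3, e4⟩ := h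
    have k1 : a * g = a' * g' := by omega
    have k2 : a * (g + b) = a' * (g' + b') := by omega
    have k3 : g * d = g' * d' := by omega
    obtain rfl := eq_of_mul_eq_of_coprime hco hco' k1 k2
    obtain rfl := Nat.eq_of_mul_eq_mul_left ha k1
    obtain rfl := Nat.add_left_cancel (Nat.eq_of_mul_eq_mul_left ha k2)
    obtain rfl := Nat.eq_of_mul_eq_mul_left hg k3
    rfl

lemma le_card_sqSols {Y K M : ℕ} (hK : 50 * Y ^ 2 ≤ K) (hM : K ≤ M) :
    (Y : ℝ) ^ 2 / 8 * Real.log (Y + 1) ≤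
      (Finset.card {z ∈ sqSols M | z.1.1 ^ 2 + z.1.2 ^ 2 ≤ K} : ℕ) := by
  refine le_trans ?_ (Nat.cast_le.2 (sum_totient_mul_sq_le_card hK hM))
  have h := log_le_two_mul_sum_totient_div_sq Y
  have hstep : (Y : ℝ) ^ 2 / 4 * ∑ g ∈ Finset.Icc 1 Y, (Nat.totient g : ℝ) / g ^ 2 ≤
      ((∑ g ∈ Finset.Icc 1 Y, Nat.totient g * (Y / g) ^ 2 : ℕ) : ℝ) := by
    rw [Finset.mul_sum]
    push_cast
    refine Finset.sum_le_sum fun g hg => ?_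
    obtain ⟨hg1, hg2⟩ := Finset.mem_Icc.1 hg
    have hg' : (0:ℝ) < g := by exact_mod_cast hg1
    have h2 : (Y : ℝ) / (2 * g) ≤ (Y / g : ℕ) := by
      rw [div_le_iff₀ (by positivity)]
      have h3 := Nat.lt_div_mul_add hg1 (a := Y)
      have h4 : 1 ≤ Y / g := (Nat.one_le_div_iff hg1).2 hg2
      have : Y ≤ (Y / g) * (2 * g) := by nlinarith
      exact_mod_cast this
    calc (Y : ℝ) ^ 2 / 4 * ((Nat.totient g : ℝ) / g ^ 2)
        = (Nat.totient g : ℝ) * (Y / (2 * g)) ^ 2 := by field_simp; norm_num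
      _ ≤ _ := by gcongr
  refine le_trans ?_ hstep
  nlinarith [sq_nonneg (Y : ℝ)]

lemma abs_incrCoeff_le_two_pi_div {ℓ : ℝ} (hℓ : 0 ≤ ℓ) {N : ℕ} (hN : 0 < N) (h : N ^ 2 * ℓ ≤ 1)
    (n : ℕ) : |incrCoeff ℓ n| ≤ 2 * π / N ^ 2 := by
  have hN' : (0:ℝ) < N := by exact_mod_cast hN
  refine (abs_incrCoeff_le hℓ n).trans ?_
  rw [le_div_iff₀ (by positivity)]
  nlinarith [Real.pi_pos]

lemma one_div_sq_le_incrCoeff {ℓ : ℝ} {N : ℕ} (hN : 0 < N) (h : N ^ 2 * ℓ ≤ 1)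
    (h4 : 1 ≤ 4 * (N ^ 2 * ℓ)) {n : ℕ} (hn : 0 < n) (hnN : 2 * n ^ 2 ≤ N ^ 2) :
    1 / (N : ℝ) ^ 2 ≤ incrCoeff ℓ n := by
  have hN' : (0:ℝ) < N := by exact_mod_cast hN
  have hℓ : 0 ≤ ℓ := by
    by_contra hcon
    push Not at hcon
    nlinarith [mul_neg_of_pos_of_neg (pow_pos hN' 2) hcon]
  have hnN' : 2 * (n : ℝ) ^ 2 ≤ N ^ 2 := by exact_mod_cast hnN
  refine le_trans ?_ (four_mul_le_incrCoeff hℓ hn (by nlinarith))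
  rw [div_le_iff₀ (by positivity)]
  linarith

lemma le_sum_incrCoeff_sq {ℓ : ℝ} {N M : ℕ} (hN : 2 ≤ N) (h : N ^ 2 * ℓ ≤ 1)
    (h4 : 1 ≤ 4 * (N ^ 2 * ℓ)) (hM : N ≤ M) :
    1 / (3 * (N : ℝ) ^ 3) ≤ ∑ n ∈ Finset.Icc 1 M, incrCoeff ℓ n ^ 2 := by
  have hN' : (0:ℝ) < N := by exact_mod_cast (by omega : 0 < N)
  calc 1 / (3 * (N : ℝ) ^ 3) = (N / 3 : ℝ) * (1 / (N : ℝ) ^ 2) ^ 2 := by field_simp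
    _ ≤ ((N / 2 : ℕ) : ℝ) * (1 / (N : ℝ) ^ 2) ^ 2 := by
        gcongr
        rw [div_le_iff₀ (by norm_num)]
        exact_mod_cast (by omega : N ≤ N / 2 * 3)
    _ = ∑ n ∈ Finset.Icc 1 (N / 2), (1 / (N : ℝ) ^ 2) ^ 2 := by simp
    _ ≤ ∑ n ∈ Finset.Icc 1 (N / 2), incrCoeff ℓ n ^ 2 := by
        refine Finset.sum_le_sum fun n hn => ?_
        obtain ⟨hn1, hn2⟩ := Finset.mem_Icc.1 hn
        have : 2 * n ≤ N := by omega
        have := one_div_sq_le_incrCoeff (by omega) h h4 hn1 (by nlinarith)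
        gcongr
    _ ≤ _ := Finset.sum_le_sum_of_subset_of_nonneg
        (Finset.Icc_subset_Icc le_rfl (by omega)) fun n _ _ => sq_nonneg _

lemma sum_incrCoeff_sq_le {ℓ : ℝ} (hℓ : 0 ≤ ℓ) {N M : ℕ} (hN : 0 < N) (h : N ^ 2 * ℓ ≤ 1)
    (hM : N ≤ M) :
    ∑ n ∈ Finset.Icc 1 M, incrCoeff ℓ n ^ 2 ≤ 44 / (N : ℝ) ^ 3 := by
  have hN' : (0:ℝ) < N := by exact_mod_cast hN
  have hM' : (0:ℝ) < M := by exact_mod_cast (by omega : 0 < M)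
  have hsplit : Finset.Icc 1 M = Finset.Icc 1 N ∪ Finset.Ioc N M := by
    ext n; simp only [Finset.mem_union, Finset.mem_Icc, Finset.mem_Ioc]; omega
  have hdisj : Disjoint (Finset.Icc 1 N) (Finset.Ioc N M) := by
    rw [Finset.disjoint_left]; intro n; simp only [Finset.mem_Icc, Finset.mem_Ioc]; omega
  rw [hsplit, Finset.sum_union hdisj]
  have h1 : ∑ n ∈ Finset.Icc 1 N, incrCoeff ℓ n ^ 2 ≤ 40 / (N : ℝ) ^ 3 := by
    calc _ ≤ ∑ n ∈ Finset.Icc 1 N, 40 / (N : ℝ) ^ 4 := by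
          refine Finset.sum_le_sum fun n _ => ?_
          rw [← sq_abs]
          calc _ ≤ (2 * π / (N : ℝ) ^ 2) ^ 2 := by
                gcongr; exact abs_incrCoeff_le_two_pi_div hℓ hN h n
            _ = 4 * π ^ 2 / (N : ℝ) ^ 4 := by field_simp; norm_num
            _ ≤ _ := by
                gcongr
                nlinarith [Real.pi_lt_d2, Real.pi_pos]
      _ = _ := by simp; field_simp
  have h2 : ∑ n ∈ Finset.Ioc N M, incrCoeff ℓ n ^ 2 ≤ 4 / (N : ℝ) ^ 3 := by
    calc _ ≤ ∑ n ∈ Finset.Ioc N M, 4 / (N : ℝ) ^ 2 * ((n : ℝ) ^ 2)⁻¹ := by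
          refine Finset.sum_le_sum fun n hn => ?_
          have hn : (N : ℝ) ≤ n := by exact_mod_cast (Finset.mem_Ioc.1 hn).1.le
          have hn0 : (0:ℝ) < n := by linarith
          rw [← sq_abs]
          calc _ ≤ (2 / (n : ℝ) ^ 2) ^ 2 := by gcongr; exact abs_incrCoeff_le_two_div ℓ n
            _ = 4 / (n : ℝ) ^ 2 * ((n : ℝ) ^ 2)⁻¹ := by field_simp; norm_num
            _ ≤ _ := by gcongr
      _ ≤ 4 / (N : ℝ) ^ 2 * (N : ℝ)⁻¹ := by
          rw [← Finset.mul_sum]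
          gcongr
          refine (sum_Ioc_inv_sq_le_sub hN.ne' hM).trans ?_
          have : (0:ℝ) < (M : ℝ)⁻¹ := by positivity
          linarith
      _ = _ := by field_simp
  calc _ ≤ 40 / (N : ℝ) ^ 3 + 4 / (N : ℝ) ^ 3 := add_le_add h1 h2
    _ = _ := by ring

lemma sum_filter_le_sum_of_fibers {ι : Type*} (s : Finset ι) (A : ι → ℝ) (κ : ι → ℕ) (K : ℕ) :
    ∑ i ∈ s with κ i ≤ K, ∑ j ∈ s, (if κ i = κ j then A i * A j else 0) ≤
      ∑ i ∈ s, ∑ j ∈ s, if κ i = κ j then A i * A j else 0 := by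
  rw [← Finset.sum_filter_add_sum_filter_not s (fun i => κ i ≤ K)
    (fun i => ∑ j ∈ s, if κ i = κ j then A i * A j else 0)]
  refine le_add_of_nonneg_right ?_
  have : ∑ i ∈ s with ¬ κ i ≤ K, ∑ j ∈ s, (if κ i = κ j then A i * A j else 0) =
      ∑ i ∈ s with ¬ κ i ≤ K, ∑ j ∈ s with ¬ κ j ≤ K,
        if κ i = κ j then A i * A j else 0 := by
    refine Finset.sum_congr rfl fun i hi => ?_
    rw [Finset.sum_filter]
    refine Finset.sum_congr rfl fun j _ => ?_
    have hi := (Finset.mem_filter.1 hi).2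
    by_cases hij : κ i = κ j
    · have hj : ¬ κ j ≤ K := by rwa [← hij]
      rw [if_pos hj]
    · simp [hij]
  rw [this, ← integral_norm_sq_sum_eChar _ A κ 0]
  exact intervalIntegral.integral_nonneg zero_le_one fun x _ => sq_nonneg _

lemma sum_fibers_eq_sum_sqSols (ℓ : ℝ) (M : ℕ) :
    (∑ p ∈ Finset.Icc 1 M ×ˢ Finset.Icc 1 M, ∑ q ∈ Finset.Icc 1 M ×ˢ Finset.Icc 1 M,
        if p.1 ^ 2 + p.2 ^ 2 = q.1 ^ 2 + q.2 ^ 2 then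
          (incrCoeff ℓ p.1 * incrCoeff ℓ p.2) * (incrCoeff ℓ q.1 * incrCoeff ℓ q.2) else 0) =
      ∑ z ∈ sqSols M, (incrCoeff ℓ z.1.1 * incrCoeff ℓ z.1.2) *
        (incrCoeff ℓ z.2.1 * incrCoeff ℓ z.2.2) := by
  rw [sqSols, Finset.sum_filter, eq_comm]
  exact Finset.sum_product _ _ _

lemma le_integral_incrSum_four {ℓ : ℝ} {N M : ℕ} (hN : 100 ≤ N) (h : N ^ 2 * ℓ ≤ 1)
    (h4 : 1 ≤ 4 * (N ^ 2 * ℓ)) (hM : N ^ 2 ≤ M) :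
    Real.log N / (6400 * (N : ℝ) ^ 6) ≤ ∫ x in (0:ℝ)..1, ‖incrSum ℓ M x‖ ^ 4 := by
  have hN' : (0:ℝ) < N := by exact_mod_cast (by omega : 0 < N)
  obtain ⟨Y, hY⟩ : ∃ Y, Y = N / 10 := ⟨_, rfl⟩
  have hY1 : 10 * Y ≤ N := by omega
  have hY2 : N ≤ 20 * Y := by omega
  have hY3 : N ≤ 10 * (Y + 1) := by omega
  have hcount := le_card_sqSols (Y := Y) (K := 50 * Y ^ 2) (M := M) le_rfl (by nlinarith)
  rw [integral_incrSum_four]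
  refine le_trans ?_ (sum_filter_le_sum_of_fibers (Finset.Icc 1 M ×ˢ Finset.Icc 1 M)
    (fun p => incrCoeff ℓ p.1 * incrCoeff ℓ p.2) (fun p => p.1 ^ 2 + p.2 ^ 2) (50 * Y ^ 2))
  have hre : (∑ p ∈ Finset.Icc 1 M ×ˢ Finset.Icc 1 M with p.1 ^ 2 + p.2 ^ 2 ≤ 50 * Y ^ 2,
      ∑ q ∈ Finset.Icc 1 M ×ˢ Finset.Icc 1 M,
        if p.1 ^ 2 + p.2 ^ 2 = q.1 ^ 2 + q.2 ^ 2 then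
          (incrCoeff ℓ p.1 * incrCoeff ℓ p.2) * (incrCoeff ℓ q.1 * incrCoeff ℓ q.2) else 0) =
      ∑ z ∈ sqSols M with z.1.1 ^ 2 + z.1.2 ^ 2 ≤ 50 * Y ^ 2,
        (incrCoeff ℓ z.1.1 * incrCoeff ℓ z.1.2) * (incrCoeff ℓ z.2.1 * incrCoeff ℓ z.2.2) := by
    rw [Finset.sum_filter, Finset.sum_filter, sqSols, Finset.sum_filter]
    refine Eq.trans (Finset.sum_congr rfl fun p _ => ?_) (Finset.sum_product _ _ _).symm
    by_cases hp : p.1 ^ 2 + p.2 ^ 2 ≤ 50 * Y ^ 2 <;> simp [hp]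
  rw [hre]
  have hlogN : Real.log N / 2 ≤ Real.log (Y + 1) := by
    rw [div_le_iff₀ two_pos, mul_comm, ← Real.log_rpow (by positivity)]
    refine Real.log_le_log hN' ?_
    have h3 : (N : ℝ) ≤ 10 * (Y + 1) := by exact_mod_cast hY3
    have h5 : (10 : ℝ) ≤ Y + 1 := by exact_mod_cast (by omega : 10 ≤ Y + 1)
    rw [Real.rpow_two]
    nlinarith
  have hlogN0 : 0 ≤ Real.log N := Real.log_natCast_nonneg N
  have hY20 : (N : ℝ) / 20 ≤ Y := by
    rw [div_le_iff₀ (by norm_num)]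
    exact_mod_cast (by omega : N ≤ Y * 20)
  calc Real.log N / (6400 * (N : ℝ) ^ 6)
      = ((N : ℝ) / 20) ^ 2 / 8 * (Real.log N / 2) * (1 / (N : ℝ) ^ 2) ^ 4 := by
        field_simp; ring
    _ ≤ (Y : ℝ) ^ 2 / 8 * Real.log (Y + 1) * (1 / (N : ℝ) ^ 2) ^ 4 := by gcongr
    _ ≤ (Finset.card {z ∈ sqSols M | z.1.1 ^ 2 + z.1.2 ^ 2 ≤ 50 * Y ^ 2} : ℕ) *
          (1 / (N : ℝ) ^ 2) ^ 4 := by gcongr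
    _ = ∑ z ∈ sqSols M with z.1.1 ^ 2 + z.1.2 ^ 2 ≤ 50 * Y ^ 2, (1 / (N : ℝ) ^ 2) ^ 4 := by simp
    _ ≤ _ := by
        refine Finset.sum_le_sum ?_
        rintro ⟨⟨a, b⟩, ⟨c, d⟩⟩ hz
        rw [Finset.mem_filter, mem_sqSols] at hz
        obtain ⟨⟨⟨⟨⟨ha, -⟩, ⟨hb, -⟩⟩, ⟨hc, -⟩, ⟨hd, -⟩⟩, heq⟩, hle⟩ := hz
        simp only at hle ⊢
        have hYN : 2 * (50 * Y ^ 2) ≤ N ^ 2 := by nlinarith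
        have hN0 : 0 < N := by omega
        have h1 := one_div_sq_le_incrCoeff hN0 h h4 ha (by nlinarith)
        have h2 := one_div_sq_le_incrCoeff hN0 h h4 hb (by nlinarith)
        have h3 := one_div_sq_le_incrCoeff hN0 h h4 hc (by nlinarith)
        have h5 := one_div_sq_le_incrCoeff hN0 h h4 hd (by nlinarith)
        have hpos : 0 < 1 / (N : ℝ) ^ 2 := by positivity
        calc (1 / (N : ℝ) ^ 2) ^ 4 = (1 / (N : ℝ) ^ 2 * (1 / (N : ℝ) ^ 2)) *
              (1 / (N : ℝ) ^ 2 * (1 / (N : ℝ) ^ 2)) := by ring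
          _ ≤ _ := by
            have hab := mul_le_mul h1 h2 hpos.le (hpos.trans_le h1).le
            have hcd := mul_le_mul h3 h5 hpos.le (hpos.trans_le h3).le
            exact mul_le_mul hab hcd (by positivity) ((by positivity : (0:ℝ) ≤ _).trans hab)

lemma abs_incrCoeff_mul_le {ℓ : ℝ} (hℓ : 0 ≤ ℓ) {N : ℕ} (hN : 0 < N) (h : N ^ 2 * ℓ ≤ 1)
    {a b m : ℕ} (hm : 0 < m) (hab : m ^ 2 ≤ a ^ 2 + b ^ 2) :
    |incrCoeff ℓ a * incrCoeff ℓ b| ≤ 2 * π / N ^ 2 * (4 / m ^ 2) := by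
  have hm' : (0:ℝ) < m := by exact_mod_cast hm
  have key : ∀ a b : ℕ, b ≤ a → m ^ 2 ≤ a ^ 2 + b ^ 2 →
      |incrCoeff ℓ a * incrCoeff ℓ b| ≤ 2 * π / N ^ 2 * (4 / m ^ 2) := by
    intro a b hle hab
    have h1 : m ^ 2 ≤ 2 * a ^ 2 := by nlinarith
    have h1' : (m : ℝ) ^ 2 ≤ 2 * (a : ℝ) ^ 2 := by exact_mod_cast h1
    have ha : (0:ℝ) < (a : ℝ) ^ 2 := by nlinarith [pow_pos hm' 2]
    have h2 : |incrCoeff ℓ a| ≤ 4 / (m : ℝ) ^ 2 := by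
      refine (abs_incrCoeff_le_two_div ℓ a).trans ?_
      rw [div_le_div_iff₀ ha (by positivity)]
      linarith
    rw [abs_mul, mul_comm]
    have := Real.pi_pos
    exact mul_le_mul (abs_incrCoeff_le_two_pi_div hℓ hN h b) h2 (abs_nonneg _) (by positivity)
  rcases le_total b a with hle | hle
  · exact key a b hle hab
  · rw [mul_comm (incrCoeff ℓ a)]
    exact key b a hle (by omega)

lemma quartic_term_le {ℓ : ℝ} (hℓ : 0 ≤ ℓ) {N M : ℕ} (hN : 0 < N) (h : N ^ 2 * ℓ ≤ 1)
    {z : (ℕ × ℕ) × (ℕ × ℕ)} (hz : z ∈ sqSols M) :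
    (incrCoeff ℓ z.1.1 * incrCoeff ℓ z.1.2) * (incrCoeff ℓ z.2.1 * incrCoeff ℓ z.2.2) ≤
      1600 / (N : ℝ) ^ 8 * ∑ i ∈ Finset.range (M + 1),
        if z ∈ sqSols (2 ^ (i + 1) * N) then (1 / 16 : ℝ) ^ i else 0 := by
  obtain ⟨⟨a, b⟩, ⟨c, d⟩⟩ := z
  have hz' := mem_sqSols.1 hz
  obtain ⟨⟨⟨⟨ha, haM⟩, ⟨hb, hbM⟩⟩, ⟨hc, hcM⟩, ⟨hd, hdM⟩⟩, heq⟩ := hz'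
  have hN' : (0:ℝ) < N := by exact_mod_cast hN
  have hpi := Real.pi_pos
  have hpi2 := Real.pi_lt_d2
  have hmono : ∀ L, M ≤ L → ((a, b), (c, d)) ∈ sqSols L := fun L hL => by
    rw [mem_sqSols]
    exact ⟨⟨⟨⟨ha, by omega⟩, hb, by omega⟩, ⟨hc, by omega⟩, hd, by omega⟩, heq⟩
  have hM : M ≤ 2 ^ (M + 1) * N := by
    have := (Nat.lt_two_pow_self (n := M + 1)).le
    nlinarith
  have hex : ∃ i, ((a, b), (c, d)) ∈ sqSols (2 ^ (i + 1) * N) := ⟨M, hmono _ hM⟩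
  classical
  obtain ⟨i, hi, hmin⟩ : ∃ i, ((a, b), (c, d)) ∈ sqSols (2 ^ (i + 1) * N) ∧
      ∀ j < i, ((a, b), (c, d)) ∉ sqSols (2 ^ (j + 1) * N) :=
    ⟨Nat.find hex, Nat.find_spec hex, fun j hj => Nat.find_min hex hj⟩
  have hiM : i ∈ Finset.range (M + 1) := by
    rw [Finset.mem_range]
    by_contra hcon
    exact hmin M (by omega) (hmono _ hM)
  have hsum : (1 / 16 : ℝ) ^ i ≤ ∑ i ∈ Finset.range (M + 1),
      if ((a, b), (c, d)) ∈ sqSols (2 ^ (i + 1) * N) then (1 / 16 : ℝ) ^ i else 0 := by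
    refine le_trans (by rw [if_pos hi]) (Finset.single_le_sum (f := fun i =>
      if ((a, b), (c, d)) ∈ sqSols (2 ^ (i + 1) * N) then (1 / 16 : ℝ) ^ i else 0)
      (fun j _ => by positivity) hiM)
  refine le_trans ?_ (mul_le_mul_of_nonneg_left hsum (by positivity))
  refine (le_abs_self _).trans ?_
  rw [abs_mul]
  simp only
  rcases Nat.eq_zero_or_pos i with rfl | hipos
  · have hs := abs_incrCoeff_le_two_pi_div hℓ hN h
    rw [abs_mul, abs_mul]
    calc _ ≤ (2 * π / (N : ℝ) ^ 2 * (2 * π / (N : ℝ) ^ 2)) *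
          (2 * π / (N : ℝ) ^ 2 * (2 * π / (N : ℝ) ^ 2)) := by
          gcongr <;> exact hs _
      _ = 16 * (π ^ 2) ^ 2 / (N : ℝ) ^ 8 := by field_simp; norm_num
      _ ≤ 1600 / (N : ℝ) ^ 8 := by
          gcongr
          have : π ^ 2 ≤ 10 := by nlinarith
          nlinarith [sq_nonneg π]
      _ = _ := by simp
  · have hmpos : 0 < 2 ^ i * N := by positivity
    have hbig : (2 ^ i * N) ^ 2 ≤ a ^ 2 + b ^ 2 := by
      have h1 := hmin (i - 1) (by omega)
      rw [Nat.sub_add_cancel hipos, mem_sqSols] at h1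
      by_contra hcon
      push Not at hcon
      refine h1 ⟨⟨⟨⟨ha, ?_⟩, hb, ?_⟩, ⟨hc, ?_⟩, hd, ?_⟩, heq⟩ <;>
        refine (lt_of_pow_lt_pow_left₀ 2 (Nat.zero_le _) ?_).le <;> omega
    have hA := abs_incrCoeff_mul_le hℓ hN h hmpos hbig
    have hB := abs_incrCoeff_mul_le hℓ hN h hmpos (heq ▸ hbig)
    refine (mul_le_mul hA hB (abs_nonneg _) (by positivity)).trans ?_
    push_cast
    have e16 : (1 / 16 : ℝ) ^ i = 1 / ((2 : ℝ) ^ i) ^ 4 := by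
      rw [← pow_mul, mul_comm, pow_mul, one_div_pow]; norm_num
    rw [e16]
    calc _ = 64 * π ^ 2 / ((N : ℝ) ^ 8 * ((2 : ℝ) ^ i) ^ 4) := by field_simp; norm_num
      _ ≤ 1600 / ((N : ℝ) ^ 8 * ((2 : ℝ) ^ i) ^ 4) := by
          gcongr
          nlinarith
      _ = _ := by field_simp

lemma integral_incrSum_four_le {ℓ : ℝ} (hℓ : 0 ≤ ℓ) {N M : ℕ} (hN : 100 ≤ N)
    (h : N ^ 2 * ℓ ≤ 1) :
    ∫ x in (0:ℝ)..1, ‖incrSum ℓ M x‖ ^ 4 ≤ 1267200 * Real.log N / (N : ℝ) ^ 6 := by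
  have hN0 : 0 < N := by omega
  have hN' : (0:ℝ) < N := by exact_mod_cast hN0
  have hlog : 1 ≤ Real.log N := by
    rw [Real.le_log_iff_exp_le hN']
    have : (100:ℝ) ≤ N := by exact_mod_cast hN
    linarith [Real.exp_one_lt_d9]
  rw [integral_incrSum_four, sum_fibers_eq_sum_sqSols]
  refine (Finset.sum_le_sum fun z hz => quartic_term_le hℓ hN0 h hz).trans ?_
  rw [← Finset.mul_sum, Finset.sum_comm]
  have hterm : ∀ i ∈ Finset.range (M + 1),
      (∑ z ∈ sqSols M, if z ∈ sqSols (2 ^ (i + 1) * N) then (1 / 16 : ℝ) ^ i else 0) ≤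
        396 * N ^ 2 * Real.log N * (1 / 2) ^ i := by
    intro i _
    rw [← Finset.sum_filter, Finset.sum_const, nsmul_eq_mul]
    have hc : (Finset.card {z ∈ sqSols M | z ∈ sqSols (2 ^ (i + 1) * N)} : ℝ) ≤
        (sqSols (2 ^ (i + 1) * N)).card := by
      exact_mod_cast Finset.card_le_card fun z hz => (Finset.mem_filter.1 hz).2
    have hc2 := card_sqSols_le (2 ^ (i + 1) * N)
    push_cast at hc2
    have hl : Real.log (2 * (2 ^ (i + 1) * N)) ≤ (i + 3) * Real.log N := by
      rw [← mul_assoc, ← pow_succ', Real.log_mul (by positivity) hN'.ne', Real.log_pow]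
      have h2 : Real.log 2 ≤ 1 := by linarith [Real.log_two_lt_d9]
      push_cast
      have hi : (0:ℝ) ≤ i := by positivity
      have h2' : 0 ≤ Real.log 2 := Real.log_nonneg (by norm_num)
      nlinarith
    have h2i : (i : ℝ) + 3 ≤ 3 * 2 ^ i := by
      have : i + 1 ≤ 2 ^ i := Nat.lt_two_pow_self
      have : i + 3 ≤ 3 * 2 ^ i := by omega
      exact_mod_cast this
    have h17 : 17 + 16 * Real.log (2 * (2 ^ (i + 1) * N)) ≤ 99 * 2 ^ i * Real.log N := by
      have hi : (0:ℝ) ≤ i := by positivity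
      nlinarith
    calc _ ≤ ((2 ^ (i + 1) * N) ^ 2 * (99 * 2 ^ i * Real.log N)) * (1 / 16 : ℝ) ^ i := by
          gcongr
          exact (hc.trans hc2).trans (by gcongr)
      _ = 396 * N ^ 2 * Real.log N * ((2 ^ i) ^ 3 * (1 / 16 : ℝ) ^ i) := by ring
      _ = _ := by
          congr 1
          rw [← pow_mul, mul_comm i, pow_mul, ← mul_pow]
          norm_num
  have hgeom : ∑ i ∈ Finset.range (M + 1), (1 / 2 : ℝ) ^ i ≤ 2 := by
    have := summable_geometric_two.sum_le_tsum (Finset.range (M + 1)) fun i _ => by positivity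
    rwa [tsum_geometric_two] at this
  calc _ ≤ 1600 / (N : ℝ) ^ 8 * (396 * N ^ 2 * Real.log N * 2) := by
        gcongr
        refine (Finset.sum_le_sum hterm).trans ?_
        rw [← Finset.mul_sum]
        gcongr
    _ = _ := by field_simp; norm_num

lemma structureFn_two_bounds {ℓ : ℝ} (hℓ : 0 ≤ ℓ) {N : ℕ} (hN : 2 ≤ N) (h : N ^ 2 * ℓ ≤ 1)
    (h4 : 1 ≤ 4 * (N ^ 2 * ℓ)) :
    1 / (3 * (N : ℝ) ^ 3) ≤ structureFn 2 ℓ ∧ structureFn 2 ℓ ≤ 44 / (N : ℝ) ^ 3 := by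
  have ht := tendsto_integral_incrSum ℓ 2
  simp only [integral_incrSum_sq] at ht
  constructor
  · exact ge_of_tendsto ht (Filter.eventually_atTop.2
      ⟨N, fun M hM => le_sum_incrCoeff_sq hN h h4 hM⟩)
  · exact le_of_tendsto ht (Filter.eventually_atTop.2
      ⟨N, fun M hM => sum_incrCoeff_sq_le hℓ (by omega) h hM⟩)

lemma structureFn_four_bounds {ℓ : ℝ} (hℓ : 0 ≤ ℓ) {N : ℕ} (hN : 100 ≤ N) (h : N ^ 2 * ℓ ≤ 1)
    (h4 : 1 ≤ 4 * (N ^ 2 * ℓ)) :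
    Real.log N / (6400 * (N : ℝ) ^ 6) ≤ structureFn 4 ℓ ∧
      structureFn 4 ℓ ≤ 1267200 * Real.log N / (N : ℝ) ^ 6 := by
  have ht := tendsto_integral_incrSum ℓ 4
  constructor
  · exact ge_of_tendsto ht (Filter.eventually_atTop.2
      ⟨N ^ 2, fun M hM => le_integral_incrSum_four hN h h4 hM⟩)
  · exact le_of_tendsto' ht fun M => integral_incrSum_four_le hℓ hN h

lemma flatnessSF_bounds {ℓ : ℝ} (hℓ : 0 ≤ ℓ) {N : ℕ} (hN : 100 ≤ N) (h : N ^ 2 * ℓ ≤ 1)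
    (h4 : 1 ≤ 4 * (N ^ 2 * ℓ)) :
    Real.log N / (6400 * 44 ^ 2) ≤ flatnessSF ℓ ∧
      flatnessSF ℓ ≤ 9 * 1267200 * Real.log N := by
  have hN' : (0:ℝ) < N := by exact_mod_cast (by omega : 0 < N)
  have hlog : 0 ≤ Real.log N := Real.log_natCast_nonneg N
  obtain ⟨a1, a2⟩ := structureFn_two_bounds hℓ (by omega) h h4
  obtain ⟨b1, b2⟩ := structureFn_four_bounds hℓ hN h h4
  have h2 : 0 < structureFn 2 ℓ := lt_of_lt_of_le (by positivity) a1
  rw [flatnessSF]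
  constructor
  · calc _ = Real.log N / (6400 * (N : ℝ) ^ 6) / (44 / (N : ℝ) ^ 3) ^ 2 := by field_simp
      _ ≤ _ := div_le_div₀ (le_trans (by positivity) b1) b1 (by positivity) (by gcongr)
  · calc _ ≤ 1267200 * Real.log N / (N : ℝ) ^ 6 / (1 / (3 * (N : ℝ) ^ 3)) ^ 2 :=
          div_le_div₀ (by positivity) b2 (by positivity) (by gcongr)
      _ = _ := by field_simp; norm_num

/-- There exist `c, C > 0` and `ℓ₀ ∈ (0,1/2)` such that for all `0 < ℓ < ℓ₀`,
`c · log(ℓ⁻¹) ≤ G_R(ℓ) ≤ C · log(ℓ⁻¹)`. -/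
theorem riemann_flatness_SF_log :
    ∃ c C ℓ₀ : ℝ, 0 < c ∧ 0 < C ∧ 0 < ℓ₀ ∧ ℓ₀ < 1/2 ∧
      ∀ ℓ : ℝ, 0 < ℓ → ℓ < ℓ₀ →
        c * Real.log ℓ⁻¹ ≤ flatnessSF ℓ ∧ flatnessSF ℓ ≤ C * Real.log ℓ⁻¹ := by
  refine ⟨1 / (3 * (6400 * 44 ^ 2)), 9 * 1267200, 1 / 100 ^ 2, by norm_num, by norm_num,
    by norm_num, by norm_num, fun ℓ hℓ hℓ0 => ?_⟩
  obtain ⟨N, hNdef⟩ : ∃ N, N = ⌊Real.sqrt ℓ⁻¹⌋₊ := ⟨_, rfl⟩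
  have hsq : Real.sqrt ℓ⁻¹ ^ 2 = ℓ⁻¹ := Real.sq_sqrt (by positivity)
  have hs0 := Real.sqrt_nonneg ℓ⁻¹
  have hle : (N : ℝ) ≤ Real.sqrt ℓ⁻¹ := hNdef ▸ Nat.floor_le hs0
  have hlt : Real.sqrt ℓ⁻¹ < N + 1 := hNdef ▸ Nat.lt_floor_add_one _
  have hN : 100 ≤ N := by
    rw [hNdef]
    refine Nat.le_floor (Real.le_sqrt_of_sq_le ?_)
    rw [le_inv_comm₀ (by norm_num) hℓ]
    norm_num at hℓ0 ⊢
    exact hℓ0.le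
  have hN' : (100:ℝ) ≤ N := by exact_mod_cast hN
  have hinv1 : (N : ℝ) ^ 2 ≤ ℓ⁻¹ := by rw [← hsq]; gcongr
  have hinv2 : ℓ⁻¹ ≤ 4 * (N : ℝ) ^ 2 := by rw [← hsq]; nlinarith
  have h1 : (N : ℝ) ^ 2 * ℓ ≤ 1 := by
    have := mul_le_mul_of_nonneg_right hinv1 hℓ.le
    rwa [inv_mul_cancel₀ hℓ.ne'] at this
  have h4 : 1 ≤ 4 * ((N : ℝ) ^ 2 * ℓ) := by
    have := mul_le_mul_of_nonneg_right hinv2 hℓ.le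
    rw [inv_mul_cancel₀ hℓ.ne'] at this
    linarith
  obtain ⟨g1, g2⟩ := flatnessSF_bounds hℓ.le hN h1 h4
  have hl0 : 0 ≤ Real.log N := Real.log_natCast_nonneg N
  have hl1 : 2 * Real.log N ≤ Real.log ℓ⁻¹ := by
    have := Real.log_le_log (by positivity) hinv1
    rwa [Real.log_pow] at this
  have hl2 : Real.log ℓ⁻¹ ≤ 3 * Real.log N := by
    have h3 : ℓ⁻¹ ≤ (N : ℝ) ^ 3 := by nlinarith [sq_nonneg (N : ℝ)]
    have := Real.log_le_log (by positivity) h3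
    rwa [Real.log_pow] at this
  constructor
  · refine le_trans ?_ g1
    linarith
  · refine g2.trans ?_
    linarith
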